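/- arXiv:1401.2042 — 4 statements merged into one kernel-verified Lean document; each statement's English description precedes it below -/
import Mathlib

section
/- Let α = (α_n)_{n≥0} be a real sequence such that the Hankel operator Γ_α is bounded on ℓ². Then Γ_α ≥ 0 and Γ_{S*α} ≥ 0 (both positive semidefinite) if and only if there exists a finite positive Borel measure ω supported on [0,1] with ω({1}) = 0 such that α_n = ∫₀¹ tⁿ dω(t) for every n ≥ 0. -/
open scoped ComplexInnerProductSpace ComplexOrder ENNReal NNReal
open MeasureTheory Filter

noncomputable section

abbrev ℓ2 : Type := lp (fun _ : ℕ => ℂ) 2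

def e (n : ℕ) : ℓ2 := lp.single 2 n 1

def IsHankelOp (α : ℕ → ℝ) (Γ : ℓ2 →L[ℂ] ℓ2) : Prop :=
  ∀ n m : ℕ, ⟪Γ (e n), e m⟫ = (α (n + m) : ℂ)

def PosOp (Γ : ℓ2 →L[ℂ] ℓ2) : Prop := ∀ x : ℓ2, 0 ≤ ⟪Γ x, x⟫

def MemL1infPP (α : ℕ → ℝ) (Γ ΓS : ℓ2 →L[ℂ] ℓ2) : Prop :=
  (∃ C : ℝ, ∀ n : ℕ, (n + 1 : ℝ) * |α n| ≤ C) ∧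
  IsHankelOp α Γ ∧ IsHankelOp (fun n => α (n + 1)) ΓS ∧ PosOp Γ ∧ PosOp ΓS
open Polynomial Topology

/-- If a functional on polynomials is nonnegative on squares and has bounded moments, then it is
nonnegative on `(1 - X) p²`. -/
lemma map_X_mul_sq_le (M : ℝ[X] →ₗ[ℝ] ℝ) (hM : ∀ p : ℝ[X], 0 ≤ M (p * p)) (C : ℝ)
    (hC : ∀ n, |M (X ^ n)| ≤ C) (p : ℝ[X]) : M (X * (p * p)) ≤ M (p * p) := by
  have bounded (q : ℝ[X]) : ∃ D : ℝ, ∀ n, M (X ^ n * q) ≤ D := by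
    induction q using Polynomial.induction_on' with
    | add a b ha hb =>
      obtain ⟨A, hA⟩ := ha
      obtain ⟨B, hB⟩ := hb
      refine ⟨A + B, fun n => ?_⟩
      rw [mul_add, map_add]
      exact add_le_add (hA n) (hB n)
    | monomial k a =>
      refine ⟨|a| * C, fun n => ?_⟩
      have : X ^ n * monomial k a = a • X ^ (n + k) := by
        rw [← C_mul_X_pow_eq_monomial, smul_eq_C_mul, pow_add]; ring
      rw [this, map_smul, smul_eq_mul]
      refine (le_abs_self _).trans ?_
      rw [abs_mul]
      exact mul_le_mul_of_nonneg_left (hC _) (abs_nonneg _)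
  obtain ⟨D, hD⟩ := bounded (p * p)
  set b : ℕ → ℝ := fun n => M (X ^ n * (p * p)) with hb
  have cauchy (n : ℕ) : b n ^ 2 ≤ b 0 * b (2 * n) := by
    have key (s : ℝ) : 0 ≤ b (2 * n) * (s * s) + (2 * b n) * s + b 0 := by
      have h := hM ((s • X ^ n + 1) * p)
      have e1 : (s • X ^ n + 1) * p * ((s • X ^ n + 1) * p)
          = (s * s) • (X ^ (2 * n) * (p * p)) + (2 * s) • (X ^ n * (p * p))
            + X ^ 0 * (p * p) := by
        simp only [smul_eq_C_mul, map_mul, map_ofNat]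
        ring
      rw [e1] at h
      simp only [map_add, map_smul, smul_eq_mul] at h
      simp only [hb]
      linarith
    have := discrim_le_zero key
    unfold discrim at this
    nlinarith
  have b0 : 0 ≤ b 0 := by simpa [hb] using hM p
  by_contra hlt
  push Not at hlt
  have hlt' : b 0 < b 1 := by simpa [hb] using hlt
  have pos : 0 < b 0 := by
    rcases b0.eq_or_lt with h | h
    · have := cauchy 1
      rw [← h] at this hlt'
      nlinarith
    · exact h
  set r : ℝ := b 1 / b 0 with hr
  have r1 : 1 < r := by rw [hr, one_lt_div pos]; exact hlt'
  have growth (k : ℕ) : b 0 * r ^ (2 ^ k) ≤ b (2 ^ k) := by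
    induction k with
    | zero => simp [hr, mul_div_cancel₀ _ pos.ne']
    | succ k ih =>
      have h1 := cauchy (2 ^ k)
      have h2 : (b 0 * r ^ (2 ^ k)) ^ 2 ≤ b (2 ^ k) ^ 2 :=
        pow_le_pow_left₀ (by positivity) ih 2
      have h3 : b 0 * (b 0 * r ^ (2 ^ (k + 1))) ≤ b 0 * b (2 ^ (k + 1)) := by
        calc b 0 * (b 0 * r ^ (2 ^ (k + 1))) = (b 0 * r ^ (2 ^ k)) ^ 2 := by
              rw [pow_succ 2 k, pow_mul]; ring
          _ ≤ _ := h2.trans (by rw [pow_succ 2 k, mul_comm (2 ^ k) 2]; exact h1)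
      exact le_of_mul_le_mul_left h3 pos
  obtain ⟨N, hN⟩ := pow_unbounded_of_one_lt (D / b 0) r1
  have h1 : r ^ N ≤ r ^ (2 ^ N) := pow_le_pow_right₀ r1.le Nat.lt_two_pow_self.le
  have h2 := (growth N).trans (hD _)
  rw [div_lt_iff₀ pos] at hN
  nlinarith

/-- The binomial ratio `k.choose j / n.choose j` approximates `(k / n) ^ j` uniformly in `k`. -/
lemma exists_tendsto_zero_abs_pow_sub_choose_div_le (j : ℕ) :
    ∃ δ : ℕ → ℝ, Tendsto δ atTop (𝓝 0) ∧ ∀ n k : ℕ, j ≤ n → 0 < n → k ≤ n →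
      |((k : ℝ) / n) ^ j - (k.choose j : ℝ) / n.choose j| ≤ δ n := by
  induction j with
  | zero => exact ⟨fun _ => 0, tendsto_const_nhds, fun n k _ _ _ => by simp⟩
  | succ j ih =>
    obtain ⟨δ, hδ, h⟩ := ih
    refine ⟨fun n => δ n + j / ((n : ℝ) - j), ?_, fun n k hj hn hk => ?_⟩
    · have : Tendsto (fun n : ℕ => (j : ℝ) / ((n : ℝ) - j)) atTop (𝓝 0) := by
        refine Tendsto.div_atTop tendsto_const_nhds ?_
        exact tendsto_atTop_add_const_right _ _ tendsto_natCast_atTop_atTop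
      simpa using hδ.add this
    · have hn' : (0 : ℝ) < n := by exact_mod_cast hn
      have hjn : (0 : ℝ) < (n : ℝ) - j := by
        have : (j : ℝ) + 1 ≤ n := by exact_mod_cast hj
        linarith
      have hkn : (k : ℝ) ≤ n := by exact_mod_cast hk
      have step (m : ℕ) : (m.choose (j + 1) : ℝ) * (j + 1) = m.choose j * ((m : ℝ) - j) := by
        rcases le_or_gt j m with hm | hm
        · have := Nat.choose_succ_right_eq m j
          rw [← Nat.cast_sub hm]
          exact_mod_cast this
        · simp [Nat.choose_eq_zero_of_lt hm, Nat.choose_eq_zero_of_lt (hm.trans (Nat.lt_succ_self j))]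
      have cpos : (0 : ℝ) < n.choose j := by
        exact_mod_cast Nat.choose_pos (by omega)
      have cpos' : (0 : ℝ) < n.choose (j + 1) := by
        exact_mod_cast Nat.choose_pos hj
      have ratio : (k.choose (j + 1) : ℝ) / n.choose (j + 1)
          = (k.choose j : ℝ) / n.choose j * (((k : ℝ) - j) / ((n : ℝ) - j)) := by
        have j1 : (j : ℝ) + 1 ≠ 0 := by positivity
        rw [← mul_div_mul_right _ _ j1, step, step, mul_div_mul_comm]
      set a : ℝ := (k.choose j : ℝ) / n.choose j with ha
      have a0 : 0 ≤ a := by positivity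
      have a1 : a ≤ 1 := by
        rw [ha, div_le_one cpos]
        exact_mod_cast Nat.choose_le_choose j hk
      set x : ℝ := (k : ℝ) / n with hx
      have x0 : 0 ≤ x := by positivity
      have x1 : x ≤ 1 := by rw [hx, div_le_one hn']; exact hkn
      have diff : |x - ((k : ℝ) - j) / ((n : ℝ) - j)| ≤ j / ((n : ℝ) - j) := by
        have : x - ((k : ℝ) - j) / ((n : ℝ) - j) = (1 - x) * (j / ((n : ℝ) - j)) := by
          rw [hx]; field_simp; ring
        rw [this, abs_of_nonneg (mul_nonneg (by linarith) (by positivity))]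
        exact mul_le_of_le_one_left (by positivity) (by linarith)
      have split : x ^ (j + 1) - a * (((k : ℝ) - j) / ((n : ℝ) - j))
          = (x ^ j - a) * x + a * (x - ((k : ℝ) - j) / ((n : ℝ) - j)) := by ring
      rw [ratio, split]
      refine (abs_add_le _ _).trans (add_le_add ?_ ?_)
      · rw [abs_mul, abs_of_nonneg x0]
        exact (mul_le_of_le_one_right (abs_nonneg _) x1).trans (h n k (by omega) hn hk)
      · rw [abs_mul, abs_of_nonneg a0]
        exact (mul_le_of_le_one_left (abs_nonneg _) a1).trans diff

/-- Monomials expand in the Bernstein basis with binomial ratios as coefficients. -/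
lemma sum_choose_smul_bernsteinPolynomial {n j : ℕ} (hj : j ≤ n) :
    ∑ k ∈ Finset.range (n + 1), (((k.choose j : ℝ) / n.choose j) • bernsteinPolynomial ℝ n k)
      = X ^ j := by
  have cpos : (n.choose j : ℝ) ≠ 0 := by
    exact_mod_cast (Nat.choose_pos hj).ne'
  obtain ⟨m, rfl⟩ := Nat.exists_eq_add_of_le hj
  have shift : j + m + 1 = j + (m + 1) := by ring
  rw [shift, Finset.sum_range_add, Finset.sum_eq_zero, zero_add]
  · have : ∀ i ∈ Finset.range (m + 1),
        ((((j + i).choose j : ℝ) / (j + m).choose j) • bernsteinPolynomial ℝ (j + m) (j + i))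
          = X ^ j * bernsteinPolynomial ℝ m i := by
      intro i _
      have h := Nat.choose_mul (n := j + m) (k := j + i) (s := j) (by omega)
      have h' : ((j + m).choose (j + i) : ℝ) * (j + i).choose j = (j + m).choose j * m.choose i := by
        simpa using congrArg (Nat.cast (R := ℝ)) h
      have h'' : (((j + i).choose j : ℝ) / (j + m).choose j) * (j + m).choose (j + i)
          = m.choose i := by
        field_simp
        linarith
      have e2 : j + m - (j + i) = m - i := by omega
      rw [bernsteinPolynomial, bernsteinPolynomial, smul_eq_C_mul, e2, ← C_eq_natCast,
        ← C_eq_natCast, ← h'', C_mul]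
      simp only [map_natCast]
      ring
    rw [Finset.sum_congr rfl this, ← Finset.mul_sum, bernsteinPolynomial.sum, mul_one]
  · intro k hk
    rw [Nat.choose_eq_zero_of_lt (Finset.mem_range.1 hk)]
    simp

/-- **Hausdorff moment problem**: a functional on polynomials which is nonnegative on the Bernstein
polynomials is given by a finite measure on the unit interval. -/
theorem exists_finiteMeasure_moment (L : ℝ[X] →ₗ[ℝ] ℝ)
    (hL : ∀ n k, k ≤ n → 0 ≤ L (bernsteinPolynomial ℝ n k)) :
    ∃ μ : FiniteMeasure unitInterval, ∀ j : ℕ, ∫ t, (t : ℝ) ^ j ∂(μ : Measure unitInterval)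
      = L (X ^ j) := by
  let x (n k : ℕ) : unitInterval := Set.projIcc 0 1 zero_le_one ((k : ℝ) / n)
  let c (n k : ℕ) : ℝ≥0 := (L (bernsteinPolynomial ℝ n k)).toNNReal
  let ν (n : ℕ) : Measure unitInterval :=
    ∑ k ∈ Finset.range (n + 1), c n k • Measure.dirac (x n k)
  have hν (n : ℕ) : IsFiniteMeasure (ν n) := by infer_instance
  let μs (n : ℕ) : FiniteMeasure unitInterval := ⟨ν n, hν n⟩
  have hc (n k : ℕ) (hk : k ∈ Finset.range (n + 1)) :
      (c n k : ℝ) = L (bernsteinPolynomial ℝ n k) :=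
    Real.coe_toNNReal _ (hL n k (by simpa [Nat.lt_succ_iff] using hk))
  have csum (n : ℕ) : ∑ k ∈ Finset.range (n + 1), (c n k : ℝ) = L 1 := by
    rw [Finset.sum_congr rfl (hc n), ← map_sum, bernsteinPolynomial.sum]
  have mass (n : ℕ) : (μs n).mass ≤ (L 1).toNNReal := by
    have : ((μs n).mass : ℝ≥0∞) = ∑ k ∈ Finset.range (n + 1), (c n k : ℝ≥0∞) := by
      rw [FiniteMeasure.ennreal_mass]
      change ν n Set.univ = _
      rw [Measure.finsetSum_apply]
      refine Finset.sum_congr rfl fun k _ => ?_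
      rw [Measure.smul_apply, measure_univ, ENNReal.smul_def, smul_eq_mul, mul_one]
    have h : (μs n).mass = ∑ k ∈ Finset.range (n + 1), c n k := by exact_mod_cast this
    rw [h, ← csum n, ← NNReal.coe_sum, Real.toNNReal_coe]
  have integral_pow (n j : ℕ) (hn : 0 < n) : ∫ t, (t : ℝ) ^ j ∂(ν n)
      = ∑ k ∈ Finset.range (n + 1), c n k * ((k : ℝ) / n) ^ j := by
    rw [integral_finsetSum_measure]
    · refine Finset.sum_congr rfl fun k hk => ?_
      have hn' : (0 : ℝ) < n := by exact_mod_cast hn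
      have hk' : (k : ℝ) ≤ n := by exact_mod_cast Nat.lt_succ_iff.1 (Finset.mem_range.1 hk)
      have mem : (k : ℝ) / n ∈ Set.Icc (0 : ℝ) 1 :=
        ⟨by positivity, (div_le_one hn').2 hk'⟩
      rw [integral_smul_nnreal_measure, integral_dirac, NNReal.smul_def, smul_eq_mul]
      simp only [x, Set.projIcc_of_mem zero_le_one mem]
    · intro k _
      exact Continuous.integrable_of_hasCompactSupport (by fun_prop)
        (HasCompactSupport.of_compactSpace _)
  have lim (j : ℕ) : Tendsto (fun n => ∫ t, (t : ℝ) ^ j ∂(ν n)) atTop (𝓝 (L (X ^ j))) := by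
    obtain ⟨δ, hδ, h⟩ := exists_tendsto_zero_abs_pow_sub_choose_div_le j
    rw [tendsto_iff_norm_sub_tendsto_zero]
    have hδ' : Tendsto (fun n => L 1 * δ n) atTop (𝓝 0) := by simpa using hδ.const_mul (L 1)
    refine squeeze_zero' (Eventually.of_forall fun _ => norm_nonneg _) ?_ hδ'
    filter_upwards [eventually_ge_atTop (j + 1)] with n hn
    rw [integral_pow n j (by omega), ← sum_choose_smul_bernsteinPolynomial (n := n) (j := j)
      (by omega), map_sum, ← Finset.sum_sub_distrib, ← csum n, Finset.sum_mul]
    refine (norm_sum_le _ _).trans (Finset.sum_le_sum fun k hk => ?_)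
    rw [map_smul, ← hc n k hk, smul_eq_mul, mul_comm _ (c n k : ℝ), ← mul_sub, norm_mul,
      Real.norm_of_nonneg (c n k).coe_nonneg, Real.norm_eq_abs]
    exact mul_le_mul_of_nonneg_left (h n k (by omega) (by omega)
      (Nat.lt_succ_iff.1 (Finset.mem_range.1 hk))) (c n k).2
  have compact := isCompact_setOfPred_finiteMeasure_le_of_compactSpace unitInterval (L 1).toNNReal
  let U : Ultrafilter ℕ := Ultrafilter.of atTop
  have hU : (U : Filter ℕ) ≤ atTop := Ultrafilter.of_le atTop
  obtain ⟨μ, -, hμ⟩ := isCompact_iff_ultrafilter_le_nhds'.1 compact (U.map μs)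
    (Ultrafilter.mem_map.2 (Filter.univ_mem' mass))
  have hμ' : Tendsto μs U (𝓝 μ) := hμ
  rw [FiniteMeasure.tendsto_iff_forall_integral_tendsto] at hμ'
  refine ⟨μ, fun j => ?_⟩
  have := hμ' (BoundedContinuousFunction.mkOfCompact ⟨fun t => (t : ℝ) ^ j, by fun_prop⟩)
  exact tendsto_nhds_unique this ((lim j).mono_left hU)

/-- The linear functional on polynomials with prescribed moments. -/
def momentFunctional (α : ℕ → ℝ) : ℝ[X] →ₗ[ℝ] ℝ :=
  Polynomial.lsum fun n => LinearMap.toSpanSingleton ℝ ℝ (α n)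

lemma momentFunctional_monomial (α : ℕ → ℝ) (n : ℕ) (a : ℝ) :
    momentFunctional α (monomial n a) = a * α n := by
  simp [momentFunctional]

lemma momentFunctional_X_pow (α : ℕ → ℝ) (n : ℕ) : momentFunctional α (X ^ n) = α n := by
  rw [← monomial_one_right_eq_X_pow, momentFunctional_monomial, one_mul]

lemma momentFunctional_X_mul (α : ℕ → ℝ) (p : ℝ[X]) :
    momentFunctional α (X * p) = momentFunctional (fun n => α (n + 1)) p := by
  induction p using Polynomial.induction_on' with
  | add a b ha hb => rw [mul_add, map_add, map_add, ha, hb]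
  | monomial n a => rw [X_mul_monomial, momentFunctional_monomial, momentFunctional_monomial]

lemma inner_hankel_sum {α : ℕ → ℝ} {Γ : ℓ2 →L[ℂ] ℓ2} (hΓ : IsHankelOp α Γ) (s : Finset ℕ)
    (c : ℕ → ℂ) :
    ⟪Γ (∑ i ∈ s, c i • e i), ∑ i ∈ s, c i • e i⟫
      = ∑ i ∈ s, ∑ j ∈ s, (starRingEnd ℂ) (c i) * c j * (α (i + j) : ℂ) := by
  rw [map_sum, sum_inner]
  refine Finset.sum_congr rfl fun i _ => ?_
  rw [inner_sum]
  refine Finset.sum_congr rfl fun j _ => ?_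
  rw [map_smul, inner_smul_left, inner_smul_right, hΓ i j]
  ring

lemma momentFunctional_mul_self_nonneg {α : ℕ → ℝ} {Γ : ℓ2 →L[ℂ] ℓ2} (hΓ : IsHankelOp α Γ)
    (h : PosOp Γ) (p : ℝ[X]) : 0 ≤ momentFunctional α (p * p) := by
  have h1 := h (∑ i ∈ p.support, ((p.coeff i : ℝ) : ℂ) • e i)
  rw [inner_hankel_sum hΓ] at h1
  have h2 : momentFunctional α (p * p)
      = ∑ i ∈ p.support, ∑ j ∈ p.support, p.coeff i * p.coeff j * α (i + j) := by
    conv_lhs => rw [p.as_sum_support, Finset.sum_mul_sum]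
    simp only [map_sum, monomial_mul_monomial, momentFunctional_monomial]
  rw [h2]
  simp only [Complex.conj_ofReal] at h1
  exact_mod_cast h1

lemma tendsto_zero_of_isHankelOp {α : ℕ → ℝ} {Γ : ℓ2 →L[ℂ] ℓ2} (hΓ : IsHankelOp α Γ) :
    Tendsto α atTop (𝓝 0) := by
  have h1 := (lp.memℓp (Γ (e 0))).summable (by norm_num)
  have h2 (n : ℕ) : ‖(Γ (e 0)) n‖ = |α n| := by
    have h := hΓ 0 n
    rw [show e n = lp.single 2 n 1 from rfl, lp.inner_single_right] at h
    have h' := congrArg norm h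
    simpa [norm_inner_symm] using h'
  have h3 := h1.tendsto_atTop_zero
  simp only [h2, ENNReal.toReal_ofNat, Real.rpow_ofNat, sq_abs] at h3
  have h4 := h3.sqrt
  simp only [Real.sqrt_sq_eq_abs, Real.sqrt_zero] at h4
  exact (tendsto_zero_iff_abs_tendsto_zero _).2 h4

lemma posOp_of_moments {α : ℕ → ℝ} {Γ : ℓ2 →L[ℂ] ℓ2} (hΓ : IsHankelOp α Γ) (ν : Measure ℝ)
    (hpow : ∀ n : ℕ, Integrable (fun t : ℝ => t ^ n) ν) (hα : ∀ n, α n = ∫ t, t ^ n ∂ν) :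
    PosOp Γ := by
  have fin (s : Finset ℕ) (c : ℕ → ℂ) :
      0 ≤ ⟪Γ (∑ i ∈ s, c i • e i), ∑ i ∈ s, c i • e i⟫ := by
    have hi (i j : ℕ) : Integrable
        (fun t : ℝ => (starRingEnd ℂ) (c i) * c j * ((t ^ (i + j) : ℝ) : ℂ)) ν :=
      (hpow _).ofReal.const_mul _
    have h1 : ∑ i ∈ s, ∑ j ∈ s, (starRingEnd ℂ) (c i) * c j * (α (i + j) : ℂ)
        = ∫ t : ℝ, ((Complex.normSq (∑ i ∈ s, c i * (t : ℂ) ^ i) : ℝ) : ℂ) ∂ν := by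
      have h2 (t : ℝ) : ((Complex.normSq (∑ i ∈ s, c i * (t : ℂ) ^ i) : ℝ) : ℂ)
          = ∑ i ∈ s, ∑ j ∈ s, (starRingEnd ℂ) (c i) * c j * ((t ^ (i + j) : ℝ) : ℂ) := by
        rw [Complex.normSq_eq_conj_mul_self, map_sum, Finset.sum_mul_sum]
        refine Finset.sum_congr rfl fun i _ => Finset.sum_congr rfl fun j _ => ?_
        simp only [map_mul, map_pow, Complex.conj_ofReal]
        push_cast
        ring
      simp only [h2]
      rw [integral_finsetSum _ fun i _ => integrable_finsetSum _ fun j _ => hi i j]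
      refine Finset.sum_congr rfl fun i _ => ?_
      rw [integral_finsetSum _ fun j _ => hi i j]
      refine Finset.sum_congr rfl fun j _ => ?_
      rw [integral_const_mul, integral_complex_ofReal, hα]
    rw [inner_hankel_sum hΓ, h1, integral_complex_ofReal]
    exact_mod_cast integral_nonneg fun t => Complex.normSq_nonneg _
  intro x
  have hx : HasSum (fun i => x i • e i) x := by
    have := lp.hasSum_single (p := 2) (by norm_num) x
    convert this using 2 with i
    rw [e, ← lp.single_smul, smul_eq_mul, mul_one]
  have hcont : Continuous fun y : ℓ2 => ⟪Γ y, y⟫ := by fun_prop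
  exact ge_of_tendsto' ((hcont.tendsto x).comp hx) fun s => fin s _

lemma bernstein_nonneg_of_sq (L : ℝ[X] →ₗ[ℝ] ℝ) (h0 : ∀ p, 0 ≤ L (p * p))
    (h1 : ∀ p, 0 ≤ L (X * (p * p))) (C : ℝ) (hC : ∀ n, |L (X ^ n)| ≤ C) (n k : ℕ) :
    0 ≤ L (bernsteinPolynomial ℝ n k) := by
  let M : ℝ[X] →ₗ[ℝ] ℝ := L ∘ₗ LinearMap.mulLeft ℝ X
  have hM (p : ℝ[X]) : M p = L (X * p) := rfl
  have h2 (p : ℝ[X]) : 0 ≤ L ((1 - X) * (p * p)) := by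
    rw [sub_mul, one_mul, map_sub]
    exact sub_nonneg.2 (map_X_mul_sq_le L h0 C hC p)
  have h3 (p : ℝ[X]) : 0 ≤ L (X * (1 - X) * (p * p)) := by
    have := map_X_mul_sq_le M h1 C (fun n => by rw [hM, ← pow_succ']; exact hC _) p
    rw [hM, hM] at this
    have e1 : X * (1 - X) * (p * p) = X * (p * p) - X * (X * (p * p)) := by ring
    rw [e1, map_sub]
    exact sub_nonneg.2 this
  have key (a b : ℕ) : 0 ≤ L (X ^ a * (1 - X) ^ b) := by
    rcases Nat.even_or_odd' a with ⟨a, rfl | rfl⟩ <;>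
      rcases Nat.even_or_odd' b with ⟨b, rfl | rfl⟩
    · convert h0 (X ^ a * (1 - X) ^ b) using 2; ring
    · convert h2 (X ^ a * (1 - X) ^ b) using 2; ring
    · convert h1 (X ^ a * (1 - X) ^ b) using 2; ring
    · convert h3 (X ^ a * (1 - X) ^ b) using 2; ring
  have e1 : bernsteinPolynomial ℝ n k = (n.choose k : ℝ) • (X ^ k * (1 - X) ^ (n - k)) := by
    rw [bernsteinPolynomial, smul_eq_C_mul, map_natCast, mul_assoc]
  rw [e1, map_smul]
  exact mul_nonneg (Nat.cast_nonneg _) (key _ _)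

lemma integrable_pow_of_Icc (ω : Measure ℝ) [IsFiniteMeasure ω]
    (h : ω (Set.Icc (0 : ℝ) 1)ᶜ = 0) (n : ℕ) : Integrable (fun t : ℝ => t ^ n) ω := by
  refine Integrable.of_bound (by fun_prop) 1 ?_
  filter_upwards [compl_mem_ae_iff.2 h] with t ht
  rw [compl_compl] at ht
  rw [Real.norm_of_nonneg (pow_nonneg ht.1 n)]
  exact pow_le_one₀ ht.1 ht.2

lemma measure_singleton_one_eq_zero (ω : Measure ℝ) [IsFiniteMeasure ω]
    (h : ω (Set.Icc (0 : ℝ) 1)ᶜ = 0)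
    (hlim : Tendsto (fun n : ℕ => ∫ t, t ^ n ∂ω) atTop (𝓝 0)) : ω {1} = 0 := by
  have bound (n : ℕ) : ω.real {1} ≤ ∫ t, t ^ n ∂ω := by
    rw [← integral_indicator_one (measurableSet_singleton (1 : ℝ))]
    refine integral_mono_ae ((integrable_const 1).indicator (measurableSet_singleton _))
      (integrable_pow_of_Icc ω h n) ?_
    filter_upwards [compl_mem_ae_iff.2 h] with t ht
    rw [compl_compl] at ht
    by_cases ht1 : t = 1
    · simp [ht1]
    · simpa [ht1] using pow_nonneg ht.1 n
  have h0 := ge_of_tendsto' hlim bound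
  exact (measureReal_eq_zero_iff).1 (le_antisymm h0 measureReal_nonneg)

theorem statement0 (α : ℕ → ℝ) (Γ ΓS : ℓ2 →L[ℂ] ℓ2)
    (hΓ : IsHankelOp α Γ) (hΓS : IsHankelOp (fun n => α (n + 1)) ΓS) :
    (PosOp Γ ∧ PosOp ΓS) ↔
      ∃ ω : MeasureTheory.Measure ℝ, MeasureTheory.IsFiniteMeasure ω ∧
        ω (Set.Icc (0 : ℝ) 1)ᶜ = 0 ∧ ω {1} = 0 ∧
        ∀ n : ℕ, α n = ∫ t, t ^ n ∂ω := by
  constructor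
  · rintro ⟨hP, hPS⟩
    have hlim := tendsto_zero_of_isHankelOp hΓ
    obtain ⟨C, hC⟩ := hlim.abs.bddAbove_range
    obtain ⟨μ, hμ⟩ := exists_finiteMeasure_moment (momentFunctional α) fun n k _ =>
      bernstein_nonneg_of_sq _ (momentFunctional_mul_self_nonneg hΓ hP)
        (fun p => by
          rw [momentFunctional_X_mul]
          exact momentFunctional_mul_self_nonneg hΓS hPS p) C
        (fun n => by
          rw [momentFunctional_X_pow]
          exact hC ⟨n, rfl⟩) n k
    let ω : Measure ℝ := (μ : Measure unitInterval).map Subtype.val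
    have hfin : IsFiniteMeasure ω := by infer_instance
    have hsupp : ω (Set.Icc (0 : ℝ) 1)ᶜ = 0 := by
      rw [Measure.map_apply measurable_subtype_coe measurableSet_Icc.compl]
      convert measure_empty (μ := (μ : Measure unitInterval))
      ext t
      simp
    have hmom (n : ℕ) : α n = ∫ t, t ^ n ∂ω := by
      rw [integral_map measurable_subtype_coe.aemeasurable (by fun_prop), hμ,
        momentFunctional_X_pow]
    refine ⟨ω, hfin, hsupp, measure_singleton_one_eq_zero ω hsupp ?_, hmom⟩
    simpa only [← hmom] using hlim
  · rintro ⟨ω, hfin, hsupp, -, hmom⟩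
    have hpow := integrable_pow_of_Icc ω hsupp
    refine ⟨posOp_of_moments hΓ ω hpow hmom, ?_⟩
    let τ : Measure ℝ := ω.withDensity fun t => ENNReal.ofReal t
    have hpos : ∀ᵐ t ∂ω, 0 ≤ t := by
      filter_upwards [compl_mem_ae_iff.2 hsupp] with t ht
      rw [compl_compl] at ht
      exact ht.1
    have hmul (n : ℕ) : (fun t : ℝ => (ENNReal.ofReal t).toReal • t ^ n) =ᵐ[ω]
        fun t => t ^ (n + 1) := by
      filter_upwards [hpos] with t ht
      rw [ENNReal.toReal_ofReal ht, smul_eq_mul, pow_succ']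
    have hlt : ∀ᵐ t ∂ω, ENNReal.ofReal t < ∞ := ae_of_all _ fun _ => ENNReal.ofReal_lt_top
    refine posOp_of_moments hΓS τ (fun n => ?_) (fun n => ?_)
    · rw [integrable_withDensity_iff_integrable_smul' (by fun_prop) hlt]
      exact (hpow (n + 1)).congr (hmul n).symm
    · rw [integral_withDensity_eq_integral_toReal_smul (by fun_prop) hlt,
        integral_congr_ae (hmul n)]
      exact hmom (n + 1)
end
end

section
/- Let α = (α_n)_{n≥0} be a real sequence such that the Hankel operator Γ_α is bounded on ℓ² and Γ_α ≥ 0. Then (1/4)·sup_{n≥0}(n+1)|α_n| ≤ ‖Γ_α‖ ≤ π·sup_{n≥0}(n+1)|α_n|, where ‖Γ_α‖ is the operator norm. -/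
open scoped ComplexInnerProductSpace ComplexOrder ENNReal NNReal
open MeasureTheory Filter

noncomputable section

lemma inner_e_e (n m : ℕ) : ⟪e n, e m⟫ = if n = m then (1 : ℂ) else 0 := by
  unfold e
  rw [lp.inner_single_left]
  by_cases h : n = m
  · subst h; simp
  · simp [h]

lemma norm_e (n : ℕ) : ‖e n‖ = 1 := by
  simp [e, lp.norm_single]

section LowerBound

variable {α : ℕ → ℝ} {Γ : ℓ2 →L[ℂ] ℓ2}

lemma IsHankelOp.abs_le_norm (hΓ : IsHankelOp α Γ) (n : ℕ) : |α n| ≤ ‖Γ‖ := by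
  have h := hΓ n 0
  have h1 : ‖⟪Γ (e n), e 0⟫‖ ≤ ‖Γ (e n)‖ * ‖e 0‖ := norm_inner_le_norm _ _
  have h2 := Γ.le_opNorm (e n)
  rw [h, norm_e, Complex.norm_real, Real.norm_eq_abs] at h1
  rw [norm_e] at h2
  simp only [add_zero, mul_one] at h1 h2
  exact h1.trans h2

lemma IsHankelOp.two_mul_abs_le (hΓ : IsHankelOp α Γ) (hpos : PosOp Γ) (k l : ℕ) :
    2 * |α (k + l)| ≤ α (k + k) + α (l + l) := by
  have h1 := hpos (e k + e l)
  have h2 := hpos (e k - e l)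
  simp only [map_add, map_sub, inner_add_left, inner_add_right, inner_sub_left, inner_sub_right,
    hΓ _ _, add_comm l k] at h1 h2
  norm_cast at h1 h2
  have : |α (k + l)| ≤ (α (k + k) + α (l + l)) / 2 := abs_le.2 ⟨by linarith, by linarith⟩
  linarith

/-- A bounded midpoint-convex sequence is nonincreasing. -/
lemma antitone_of_convex_of_bounded {b : ℕ → ℝ} {C : ℝ} (hb : ∀ n, b n ≤ C)
    (hconv : ∀ n, 2 * b (n + 1) ≤ b n + b (n + 2)) : Antitone b := by
  refine antitone_nat_of_succ_le fun k => ?_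
  by_contra! hlt
  have hd : ∀ n, b (k + 1) - b k ≤ b (k + n + 1) - b (k + n) := by
    intro n
    induction n with
    | zero => simp
    | succ n ih =>
      have := hconv (k + n)
      have e1 : k + (n + 1) = k + n + 1 := by ring
      have e2 : k + n + 1 + 1 = k + n + 2 := by ring
      rw [e1, e2]
      linarith
  have hg : ∀ n : ℕ, b k + n * (b (k + 1) - b k) ≤ b (k + n) := by
    intro n
    induction n with
    | zero => simp
    | succ n ih =>
      have := hd n
      rw [← add_assoc]
      push_cast
      linarith
  obtain ⟨n, hn⟩ := exists_nat_gt ((C - b k) / (b (k + 1) - b k))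
  rw [div_lt_iff₀ (by linarith)] at hn
  linarith [hg n, hb (k + n)]

lemma IsHankelOp.antitone_even (hΓ : IsHankelOp α Γ) (hpos : PosOp Γ) :
    Antitone fun k => α (2 * k) := by
  refine antitone_of_convex_of_bounded (C := ‖Γ‖)
    (fun n => (le_abs_self _).trans (hΓ.abs_le_norm _)) fun n => ?_
  have h := hΓ.two_mul_abs_le hpos n (n + 2)
  have h' := le_abs_self (α (n + (n + 2)))
  rw [show n + (n + 2) = 2 * (n + 1) by ring, show n + n = 2 * n by ring,
    show n + 2 + (n + 2) = 2 * (n + 2) by ring] at h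
  rw [show n + (n + 2) = 2 * (n + 1) by ring] at h'
  linarith

lemma IsHankelOp.abs_le_even (hΓ : IsHankelOp α Γ) (hpos : PosOp Γ) (n : ℕ) :
    |α n| ≤ α (2 * (n / 2)) := by
  have h := hΓ.two_mul_abs_le hpos (n / 2) (n - n / 2)
  have h' : α (2 * (n - n / 2)) ≤ α (2 * (n / 2)) := hΓ.antitone_even hpos (by omega)
  rw [show n / 2 + (n - n / 2) = n by omega, show n / 2 + n / 2 = 2 * (n / 2) by omega,
    show n - n / 2 + (n - n / 2) = 2 * (n - n / 2) by omega] at h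
  linarith

lemma IsHankelOp.succ_mul_le_norm (hΓ : IsHankelOp α Γ) (hpos : PosOp Γ) (m : ℕ) :
    (m + 1 : ℝ) * α (4 * m) ≤ ‖Γ‖ := by
  set x : ℓ2 := ∑ i ∈ Finset.range (m + 1), e (2 * i) with hx
  have hnorm : ‖x‖ ^ 2 = m + 1 := by
    have h : ⟪x, x⟫ = ((m + 1 : ℝ) : ℂ) := by
      simp only [hx, sum_inner, inner_sum, inner_e_e]
      have : ∀ i j : ℕ, (2 * i = 2 * j) ↔ i = j := by omega
      simp only [this, Finset.sum_ite_eq']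
      rw [Finset.sum_ite_of_true (fun _ h => h)]
      simp
    rw [← Complex.ofReal_inj, ← h, inner_self_eq_norm_sq_to_K]
    push_cast
    rfl
  have hquad : ⟪Γ x, x⟫ =
      ((∑ i ∈ Finset.range (m + 1), ∑ j ∈ Finset.range (m + 1), α (2 * i + 2 * j) : ℝ) : ℂ) := by
    simp only [hx, map_sum, sum_inner, inner_sum, hΓ _ _]
    push_cast
    rw [Finset.sum_comm]
  have hlow : (m + 1 : ℝ) * ((m + 1) * α (4 * m)) ≤
      ∑ i ∈ Finset.range (m + 1), ∑ j ∈ Finset.range (m + 1), α (2 * i + 2 * j) := by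
    have : (m + 1 : ℝ) * ((m + 1) * α (4 * m)) =
        ∑ i ∈ Finset.range (m + 1), ∑ j ∈ Finset.range (m + 1), α (4 * m) := by
      simp
    rw [this]
    refine Finset.sum_le_sum fun i hi => Finset.sum_le_sum fun j hj => ?_
    rw [Finset.mem_range] at hi hj
    have := hΓ.antitone_even hpos (show i + j ≤ 2 * m by omega)
    simp only at this
    convert this using 2 <;> ring
  have hup : ‖⟪Γ x, x⟫‖ ≤ ‖Γ‖ * (m + 1) := by
    rw [← hnorm]
    calc ‖⟪Γ x, x⟫‖ ≤ ‖Γ x‖ * ‖x‖ := norm_inner_le_norm _ _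
      _ ≤ ‖Γ‖ * ‖x‖ * ‖x‖ := by gcongr; exact Γ.le_opNorm x
      _ = _ := by ring
  rw [hquad, Complex.norm_real, Real.norm_eq_abs] at hup
  have hm : (0 : ℝ) < m + 1 := by positivity
  have := (hlow.trans (le_abs_self _)).trans hup
  nlinarith

lemma IsHankelOp.succ_mul_abs_le (hΓ : IsHankelOp α Γ) (hpos : PosOp Γ) (n : ℕ) :
    (n + 1 : ℝ) * |α n| ≤ 4 * ‖Γ‖ := by
  have h1 := hΓ.abs_le_even hpos n
  have h2 : α (2 * (n / 2)) ≤ α (2 * (2 * (n / 4))) :=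
    hΓ.antitone_even hpos (show 2 * (n / 4) ≤ n / 2 by omega)
  rw [show 2 * (2 * (n / 4)) = 4 * (n / 4) by ring] at h2
  have h3 := hΓ.succ_mul_le_norm hpos (n / 4)
  have h4 : (n + 1 : ℝ) ≤ 4 * ((n / 4 : ℕ) + 1) := by
    have : n + 1 ≤ 4 * (n / 4 + 1) := by omega
    exact_mod_cast this
  calc (n + 1 : ℝ) * |α n| ≤ 4 * ((n / 4 : ℕ) + 1) * α (4 * (n / 4)) := by
        gcongr
        exact h1.trans h2
    _ ≤ 4 * ‖Γ‖ := by linarith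

end LowerBound

section HilbertInequality

lemma hasDerivAt_two_mul_arctan_sqrt_div {a x : ℝ} (ha : 0 < a) (hx : 0 < x) :
    HasDerivAt (fun x => 2 * Real.arctan (√x / √a)) (√a / (√x * (a + x))) x := by
  have h := (((Real.hasDerivAt_sqrt hx.ne').div_const √a).arctan).const_mul 2
  refine h.congr_deriv ?_
  have h1 : 0 < √a := Real.sqrt_pos.2 ha
  have h2 : 0 < √x := Real.sqrt_pos.2 hx
  rw [div_pow, Real.sq_sqrt ha.le, Real.sq_sqrt hx.le]
  have h3 : a = √a ^ 2 := (Real.sq_sqrt ha.le).symm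
  field_simp
  nlinarith

lemma two_mul_sqrt_kernel_le {a c h : ℝ} (ha : 0 < a) (h0 : 0 ≤ h) (hc : h < c) :
    2 * (√a / (√c * (a + c))) ≤
      √a / (√(c + h) * (a + (c + h))) + √a / (√(c - h) * (a + (c - h))) := by
  have hc0 : 0 < c := by linarith
  have hch : 0 < c - h := by linarith
  have hsa : 0 < √a := Real.sqrt_pos.2 ha
  have s0 : 0 < √c := Real.sqrt_pos.2 hc0
  have s1 : 0 < √(c + h) := Real.sqrt_pos.2 (by linarith)
  have s2 : 0 < √(c - h) := Real.sqrt_pos.2 hch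
  have hs : √(c + h) * √(c - h) ≤ √c * √c := by
    rw [← Real.sqrt_mul (by linarith), ← Real.sqrt_mul hc0.le]
    exact Real.sqrt_le_sqrt (by nlinarith)
  have hm : (a + (c + h)) * (a + (c - h)) ≤ (a + c) * (a + c) := by nlinarith
  have hprod : (√a / (√c * (a + c))) ^ 2 ≤
      √a / (√(c + h) * (a + (c + h))) * (√a / (√(c - h) * (a + (c - h)))) := by
    rw [div_pow, div_mul_div_comm, ← sq]
    refine div_le_div_of_nonneg_left (by positivity) (by positivity) ?_
    calc √(c + h) * (a + (c + h)) * (√(c - h) * (a + (c - h)))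
        = (√(c + h) * √(c - h)) * ((a + (c + h)) * (a + (c - h))) := by ring
      _ ≤ (√c * √c) * ((a + c) * (a + c)) := by gcongr
      _ = _ := by ring
  have hA : 0 < √a / (√(c + h) * (a + (c + h))) := by positivity
  have hB : 0 < √a / (√(c - h) * (a + (c - h))) := by positivity
  have hD : 0 < √a / (√c * (a + c)) := by positivity
  generalize √a / (√(c + h) * (a + (c + h))) = A at *
  generalize √a / (√(c - h) * (a + (c - h))) = B at *
  generalize √a / (√c * (a + c)) = D at *
  refine abs_le_of_sq_le_sq' (?_ : (2 * D) ^ 2 ≤ (A + B) ^ 2) (by positivity) |>.2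
  nlinarith [sq_nonneg (A - B)]

lemma sqrt_kernel_le_sub {a c : ℝ} (ha : 0 < a) (hc : 1 / 2 ≤ c) :
    √a / (√c * (a + c)) ≤
      2 * Real.arctan (√(c + 1 / 2) / √a) - 2 * Real.arctan (√(c - 1 / 2) / √a) := by
  set G : ℝ → ℝ := fun h => 2 * Real.arctan (√(c + h) / √a) - 2 * Real.arctan (√(c - h) / √a) -
    h * (2 * (√a / (√c * (a + c)))) with hG
  have hmono : MonotoneOn G (Set.Icc 0 (1 / 2)) := by
    refine monotoneOn_of_hasDerivWithinAt_nonneg (convex_Icc _ _) ?_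
      (f' := fun h => √a / (√(c + h) * (a + (c + h))) + √a / (√(c - h) * (a + (c - h))) -
        2 * (√a / (√c * (a + c)))) ?_ ?_
    · refine Continuous.continuousOn ?_
      simp only [hG]
      have := Real.continuous_arctan
      fun_prop
    · intro h hh
      rw [interior_Icc, Set.mem_Ioo] at hh
      have d1 := (hasDerivAt_two_mul_arctan_sqrt_div ha (x := c + h) (by linarith)).comp h
        ((hasDerivAt_id h).const_add c)
      have d2 := (hasDerivAt_two_mul_arctan_sqrt_div ha (x := c - h) (by linarith)).comp h
        ((hasDerivAt_id h).const_sub c)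
      have d3 := (hasDerivAt_id h).mul_const (2 * (√a / (√c * (a + c))))
      have := ((d1.sub d2).sub d3).hasDerivWithinAt (s := interior (Set.Icc 0 (1 / 2)))
      refine this.congr_deriv ?_
      ring
    · intro h hh
      rw [interior_Icc, Set.mem_Ioo] at hh
      have := two_mul_sqrt_kernel_le ha hh.1.le (show h < c by linarith)
      linarith
  have h := hmono (show (0 : ℝ) ∈ Set.Icc (0 : ℝ) (1 / 2) by norm_num)
    (show (1 / 2 : ℝ) ∈ Set.Icc (0 : ℝ) (1 / 2) by norm_num) (by norm_num)
  simp only [hG, add_zero, sub_zero, sub_self, zero_mul] at h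
  linarith

lemma sum_sqrt_kernel_le_pi {a : ℝ} (ha : 0 < a) (N : ℕ) :
    ∑ j ∈ Finset.range N, √a / (√(j + 1 / 2) * (a + (j + 1 / 2))) ≤ Real.pi := by
  have h : ∀ j ∈ Finset.range N, √a / (√((j : ℝ) + 1 / 2) * (a + (j + 1 / 2))) ≤
      2 * Real.arctan (√((j + 1 : ℕ) : ℝ) / √a) - 2 * Real.arctan (√(j : ℝ) / √a) := by
    intro j _
    have := sqrt_kernel_le_sub ha (c := j + 1 / 2) (by simp)
    convert this using 6
    · push_cast; ring
    · ring
  refine (Finset.sum_le_sum h).trans ?_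
  rw [Finset.sum_range_sub (fun j : ℕ => 2 * Real.arctan (√(j : ℝ) / √a))]
  have := Real.arctan_lt_pi_div_two (√(N : ℝ) / √a)
  simp
  linarith

/-- **Hilbert's inequality** for finite sums, in additive form. -/
lemma sum_sum_mul_div_le (u v : ℕ → ℝ) (N : ℕ) :
    ∑ i ∈ Finset.range N, ∑ j ∈ Finset.range N, u i * v j / (i + j + 1) ≤
      Real.pi / 2 * (∑ i ∈ Finset.range N, u i ^ 2 + ∑ j ∈ Finset.range N, v j ^ 2) := by
  set k : ℕ → ℕ → ℝ := fun i j =>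
    √((i : ℝ) + 1 / 2) / (√((j : ℝ) + 1 / 2) * ((i + 1 / 2) + (j + 1 / 2))) with hk
  have hrow : ∀ (w : ℕ → ℝ), ∑ i ∈ Finset.range N, ∑ j ∈ Finset.range N, w i ^ 2 * k i j ≤
      Real.pi * ∑ i ∈ Finset.range N, w i ^ 2 := by
    intro w
    rw [Finset.mul_sum]
    refine Finset.sum_le_sum fun i _ => ?_
    rw [← Finset.mul_sum, mul_comm Real.pi]
    exact mul_le_mul_of_nonneg_left (sum_sqrt_kernel_le_pi (by positivity) N) (sq_nonneg _)
  have hterm : ∀ i j : ℕ, u i * v j / (i + j + 1) ≤ (u i ^ 2 * k i j + v j ^ 2 * k j i) / 2 := by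
    intro i j
    have hp : 0 < √((i : ℝ) + 1 / 2) := Real.sqrt_pos.2 (by positivity)
    have hq : 0 < √((j : ℝ) + 1 / 2) := Real.sqrt_pos.2 (by positivity)
    simp only [hk]
    rw [show (j + 1 / 2 : ℝ) + (i + 1 / 2) = i + j + 1 by ring,
      show (i + 1 / 2 : ℝ) + (j + 1 / 2) = i + j + 1 by ring]
    generalize √((i : ℝ) + 1 / 2) = p at *
    generalize √((j : ℝ) + 1 / 2) = q at *
    have hs : (0 : ℝ) < i + j + 1 := by positivity
    generalize (i + j + 1 : ℝ) = s at *
    rw [← sub_nonneg]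
    have : (u i ^ 2 * (p / (q * s)) + v j ^ 2 * (q / (p * s))) / 2 - u i * v j / s =
        (u i * p - v j * q) ^ 2 / (2 * p * q * s) := by
      field_simp
      ring
    rw [this]
    positivity
  refine (Finset.sum_le_sum fun i _ => Finset.sum_le_sum fun j _ => hterm i j).trans ?_
  simp only [← Finset.sum_div, Finset.sum_add_distrib]
  have h1 := hrow u
  have h2 := hrow v
  rw [Finset.sum_comm (f := fun i j => v j ^ 2 * k j i)]
  linarith

end HilbertInequality

section UpperBound

lemma opNorm_le_of_norm_inner_le {E : Type*} [NormedAddCommGroup E] [InnerProductSpace ℂ E]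
    (T : E →L[ℂ] E) {M : ℝ} (hM : 0 ≤ M)
    (h : ∀ x y, ‖⟪T x, y⟫‖ ≤ M / 2 * (‖x‖ ^ 2 + ‖y‖ ^ 2)) : ‖T‖ ≤ M := by
  refine T.opNorm_le_bound hM fun x => ?_
  by_cases hT : T x = 0
  · rw [hT, norm_zero]; positivity
  have hx : x ≠ 0 := fun hx => hT (by rw [hx, map_zero])
  have hT' : 0 < ‖T x‖ := norm_pos_iff.2 hT
  have hx' : 0 < ‖x‖ := norm_pos_iff.2 hx
  have h1 := h x (((‖x‖ / ‖T x‖ : ℝ) : ℂ) • T x)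
  have h2 : ‖x‖ / ‖T x‖ * ‖T x‖ = ‖x‖ := by field_simp
  rw [inner_smul_right, norm_mul, norm_smul, Complex.norm_real, Real.norm_eq_abs,
    abs_of_pos (by positivity), norm_inner_eq_norm_iff hT hT |>.2 ⟨1, by simp⟩, h2, ← mul_assoc,
    h2] at h1
  nlinarith

variable {α : ℕ → ℝ} {Γ : ℓ2 →L[ℂ] ℓ2}

lemma sum_norm_sq_le (x : ℓ2) (N : ℕ) : ∑ i ∈ Finset.range N, ‖x i‖ ^ 2 ≤ ‖x‖ ^ 2 := by
  have := lp.sum_rpow_le_norm_rpow (p := 2) (by norm_num) x (Finset.range N)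
  simpa using this

lemma tendsto_sum_smul_e (x : ℓ2) :
    Tendsto (fun N => ∑ i ∈ Finset.range N, x i • e i) atTop (nhds x) := by
  have h := (lp.hasSum_single (p := 2) (by norm_num) x).tendsto_sum_nat
  convert h using 4 with N i
  rw [e, ← lp.single_smul]
  simp

lemma IsHankelOp.norm_inner_le {C : ℝ} (hΓ : IsHankelOp α Γ)
    (hα : ∀ n : ℕ, (n + 1 : ℝ) * |α n| ≤ C) (x y : ℓ2) :
    ‖⟪Γ x, y⟫‖ ≤ Real.pi * C / 2 * (‖x‖ ^ 2 + ‖y‖ ^ 2) := by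
  have hC : 0 ≤ C := le_trans (by positivity) (hα 0)
  have hlim : Tendsto (fun N => ‖⟪Γ (∑ i ∈ Finset.range N, x i • e i),
      ∑ i ∈ Finset.range N, y i • e i⟫‖) atTop (nhds ‖⟪Γ x, y⟫‖) :=
    (((Γ.continuous.tendsto x).comp (tendsto_sum_smul_e x)).inner (tendsto_sum_smul_e y)).norm
  refine le_of_tendsto' hlim fun N => ?_
  simp only [map_sum, map_smul, sum_inner, inner_sum, inner_smul_left, inner_smul_right, hΓ _ _,
    Finset.mul_sum]
  calc _ ≤ ∑ j ∈ Finset.range N, ∑ i ∈ Finset.range N, C * (‖x i‖ * ‖y j‖ / (i + j + 1)) := by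
        refine (norm_sum_le _ _).trans (Finset.sum_le_sum fun j _ =>
          (norm_sum_le _ _).trans (Finset.sum_le_sum fun i _ => ?_))
        have hs : (0 : ℝ) < i + j + 1 := by positivity
        have h := hα (i + j)
        push_cast at h
        simp only [norm_mul, RCLike.norm_conj, Complex.norm_real, Real.norm_eq_abs]
        rw [← mul_div_assoc, le_div_iff₀ hs]
        calc _ = (i + j + 1) * |α (i + j)| * (‖x i‖ * ‖y j‖) := by ring
          _ ≤ _ := by gcongr
    _ = C * ∑ i ∈ Finset.range N, ∑ j ∈ Finset.range N, ‖x i‖ * ‖y j‖ / (i + j + 1) := by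
        rw [Finset.sum_comm]
        simp only [Finset.mul_sum]
    _ ≤ C * (Real.pi / 2 * (‖x‖ ^ 2 + ‖y‖ ^ 2)) := by
        gcongr
        refine (sum_sum_mul_div_le (fun i => ‖x i‖) (fun j => ‖y j‖) N).trans ?_
        gcongr
        · exact sum_norm_sq_le x N
        · exact sum_norm_sq_le y N
    _ = _ := by ring

lemma IsHankelOp.norm_le {C : ℝ} (hΓ : IsHankelOp α Γ)
    (hα : ∀ n : ℕ, (n + 1 : ℝ) * |α n| ≤ C) : ‖Γ‖ ≤ Real.pi * C := by
  have hC : 0 ≤ C := le_trans (by positivity) (hα 0)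
  exact opNorm_le_of_norm_inner_le Γ (by positivity) (hΓ.norm_inner_le hα)

end UpperBound

lemma natCast_succ_mul_ofReal_abs (n : ℕ) (r : ℝ) :
    (n + 1 : ℝ≥0∞) * ENNReal.ofReal |r| = ENNReal.ofReal ((n + 1) * |r|) := by
  rw [ENNReal.ofReal_mul (by positivity), ENNReal.ofReal_add (by positivity) zero_le_one]
  simp

theorem statement1 (α : ℕ → ℝ) (Γ : ℓ2 →L[ℂ] ℓ2)
    (hΓ : IsHankelOp α Γ) (hpos : PosOp Γ) :
    (1 / 4 : ℝ≥0∞) * (⨆ n : ℕ, (n + 1 : ℝ≥0∞) * ENNReal.ofReal |α n|) ≤ ENNReal.ofReal ‖Γ‖ ∧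
    ENNReal.ofReal ‖Γ‖ ≤
      ENNReal.ofReal Real.pi * ⨆ n : ℕ, (n + 1 : ℝ≥0∞) * ENNReal.ofReal |α n| := by
  simp only [natCast_succ_mul_ofReal_abs]
  constructor
  · rw [ENNReal.mul_iSup]
    refine iSup_le fun n => ?_
    rw [show (1 / 4 : ℝ≥0∞) = ENNReal.ofReal (1 / 4) by
      rw [ENNReal.ofReal_div_of_pos (by norm_num)]; simp, ← ENNReal.ofReal_mul (by norm_num)]
    exact ENNReal.ofReal_le_ofReal (by linarith [hΓ.succ_mul_abs_le hpos n])
  · have hfin : (⨆ n : ℕ, ENNReal.ofReal ((n + 1) * |α n|)) ≠ ⊤ :=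
      ne_top_of_le_ne_top ENNReal.ofReal_ne_top
        (iSup_le fun n => ENNReal.ofReal_le_ofReal (hΓ.succ_mul_abs_le hpos n))
    rw [← ENNReal.ofReal_toReal hfin, ← ENNReal.ofReal_mul Real.pi_pos.le]
    refine ENNReal.ofReal_le_ofReal (hΓ.norm_le fun n => ?_)
    rw [← ENNReal.ofReal_le_iff_le_toReal hfin]
    exact le_iSup (fun n : ℕ => ENNReal.ofReal ((n + 1) * |α n|)) n
end
end

section
/- Let α ∈ ℓ^{1,∞}_{++} and identify α with the element Γ_α e_0 of ℓ². Then the closed linear span of {Γ_αⁿ α : n = 0,1,2,…} equals the closed linear span of {Γ_{S*α}ⁿ α : n = 0,1,2,…}. -/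
open scoped ComplexInnerProductSpace ComplexOrder ENNReal NNReal
open MeasureTheory Filter

noncomputable section

theorem PosOp.isPositive {T : ℓ2 →L[ℂ] ℓ2} (hT : PosOp T) : T.IsPositive := by
  rw [ContinuousLinearMap.isPositive_iff_complex]
  intro x
  obtain ⟨h1, h2⟩ := Complex.nonneg_iff.1 (hT x)
  exact ⟨Complex.ext (by simp) (by simp [← h2]), h1⟩

theorem PosOp.inner_map_left {T : ℓ2 →L[ℂ] ℓ2} (hT : PosOp T) (x y : ℓ2) :
    ⟪T x, y⟫ = ⟪x, T y⟫ :=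
  hT.isPositive.isSymmetric x y

/-- A positive operator leaves invariant every closed subspace invariant under its square. -/
theorem ContinuousLinearMap.IsPositive.mapsTo_of_sq {E : Type*} [NormedAddCommGroup E]
    [InnerProductSpace ℂ E] [CompleteSpace E] {T : E →L[ℂ] E} (hT : T.IsPositive)
    {M : Submodule ℂ E} (hM : IsClosed (M : Set E)) (h : ∀ x ∈ M, T (T x) ∈ M) :
    ∀ x ∈ M, T x ∈ M := by
  have hsymm : ∀ x y, ⟪T x, y⟫ = ⟪x, T y⟫ := fun x y => hT.isSymmetric x y
  have : CompleteSpace M := hM.completeSpace_coe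
  have hcomm : Commute (T ^ 2) M.starProjection := by
    ext x
    refine (Submodule.eq_starProjection_of_mem_orthogonal ?_ ?_).symm
    · exact h _ (M.starProjection_apply_mem x)
    · have hx : x - M.starProjection x ∈ Mᗮ := M.sub_starProjection_mem_orthogonal x
      change T (T x) - T (T (M.starProjection x)) ∈ Mᗮ
      rw [← map_sub, ← map_sub, Submodule.mem_orthogonal]
      intro u hu
      rw [← hsymm, ← hsymm]
      exact (Submodule.mem_orthogonal _ _).1 hx _ (h u hu)
  have hT0 : 0 ≤ T := (ContinuousLinearMap.nonneg_iff_isPositive T).2 hT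
  have hcomm' : Commute T M.starProjection := by
    rw [← CFC.sqrt_sq T hT0]
    exact hcomm.cfcₙ_nnreal NNReal.sqrt
  intro x hx
  have hTx : T (M.starProjection x) = M.starProjection (T x) := DFunLike.congr_fun hcomm'.eq x
  rw [Submodule.starProjection_eq_self_iff.2 hx] at hTx
  rw [hTx]
  exact M.starProjection_apply_mem _

theorem inner_e_left (n : ℕ) (x : ℓ2) : ⟪e n, x⟫ = x n := by
  simp [e, lp.inner_single_left]

/-- For a self-adjoint Hankel operator `Γ` with shifted companion `ΓS`, the operator
`Γ ^ 2 - ΓS ^ 2` has rank at most one, with range spanned by `Γ e₀`. -/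
theorem IsHankelOp.sq_apply {α : ℕ → ℝ} {Γ ΓS : ℓ2 →L[ℂ] ℓ2} (hΓ : IsHankelOp α Γ)
    (hΓS : IsHankelOp (fun n => α (n + 1)) ΓS) (hs : ∀ x y, ⟪Γ x, y⟫ = ⟪x, Γ y⟫)
    (hsS : ∀ x y, ⟪ΓS x, y⟫ = ⟪x, ΓS y⟫) (x : ℓ2) :
    Γ (Γ x) = ΓS (ΓS x) + ⟪Γ (e 0), x⟫ • Γ (e 0) := by
  have hcol : ∀ n, Γ (e (n + 1)) = ΓS (e n) := by
    intro n
    ext m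
    rw [← inner_e_left, ← inner_e_left, ← inner_conj_symm, hΓ, ← inner_conj_symm (e m), hΓS]
    congr 3
    ring
  have hcoord : ∀ (y : ℓ2) (n : ℕ), (Γ y) (n + 1) = (ΓS y) n := by
    intro y n
    rw [← inner_e_left, ← inner_e_left, ← hs, ← hsS, hcol]
  have hzero : ∀ y : ℓ2, (Γ y) 0 = ⟪Γ (e 0), y⟫ := by
    intro y
    rw [← inner_e_left, hs]
  refine ext_inner_left ℂ fun y => ?_
  have hsplit := (lp.summable_inner (𝕜 := ℂ) (Γ y) (Γ x)).tsum_eq_zero_add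
  simp only [hcoord, hzero] at hsplit
  rw [← lp.inner_eq_tsum (𝕜 := ℂ) (Γ y) (Γ x), ← lp.inner_eq_tsum (𝕜 := ℂ) (ΓS y) (ΓS x)] at hsplit
  rw [inner_add_right, inner_smul_right, ← hs, ← hsS, hsplit, RCLike.inner_apply,
    inner_conj_symm, add_comm]

/-- A closed subspace containing `v` and invariant under `T` contains the closed cyclic
subspace of `T` generated by `v`. -/
theorem closure_span_pow_le {T : ℓ2 →L[ℂ] ℓ2} {v : ℓ2} {M : Submodule ℂ ℓ2}
    (hM : IsClosed (M : Set ℓ2)) (hv : v ∈ M) (h : ∀ x ∈ M, T x ∈ M) :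
    (Submodule.span ℂ (Set.range fun n : ℕ => (T ^ n) v)).topologicalClosure ≤ M := by
  refine Submodule.topologicalClosure_minimal _ (Submodule.span_le.2 ?_) hM
  rintro _ ⟨n, rfl⟩
  induction n with
  | zero => simpa using hv
  | succ n ih =>
    simp only [pow_succ', mul_apply_eq_comp]
    exact h _ ih

theorem mem_closure_span_pow (T : ℓ2 →L[ℂ] ℓ2) (v : ℓ2) :
    v ∈ (Submodule.span ℂ (Set.range fun n : ℕ => (T ^ n) v)).topologicalClosure :=
  Submodule.le_topologicalClosure _ (Submodule.subset_span ⟨0, by simp⟩)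

theorem map_mem_closure_span_pow (T : ℓ2 →L[ℂ] ℓ2) (v : ℓ2) :
    ∀ x ∈ (Submodule.span ℂ (Set.range fun n : ℕ => (T ^ n) v)).topologicalClosure,
      T x ∈ (Submodule.span ℂ (Set.range fun n : ℕ => (T ^ n) v)).topologicalClosure := by
  intro x hx
  refine map_mem_closure T.continuous hx fun y hy => ?_
  induction hy using Submodule.span_induction with
  | mem y hy =>
    obtain ⟨n, rfl⟩ := hy
    exact Submodule.subset_span ⟨n + 1, by simp [pow_succ']⟩
  | zero => simp
  | add y z _ _ hy hz =>
    rw [map_add]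
    exact Submodule.add_mem _ hy hz
  | smul c y _ hy =>
    rw [map_smul]
    exact Submodule.smul_mem _ c hy

theorem statement6 (α : ℕ → ℝ) (Γ ΓS : ℓ2 →L[ℂ] ℓ2) (hα : MemL1infPP α Γ ΓS) :
    (Submodule.span ℂ
      (Set.range fun n : ℕ => (Γ ^ n) (Γ (e 0)))).topologicalClosure =
    (Submodule.span ℂ
      (Set.range fun n : ℕ => (ΓS ^ n) (Γ (e 0)))).topologicalClosure := by
  obtain ⟨-, hΓ, hΓS, hpos, hposS⟩ := hα
  have hsq := hΓ.sq_apply hΓS hpos.inner_map_left hposS.inner_map_left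
  refine le_antisymm ?_ ?_
  · have hc := Submodule.isClosed_topologicalClosure
      (Submodule.span ℂ (Set.range fun n : ℕ => (ΓS ^ n) (Γ (e 0))))
    have hv := mem_closure_span_pow ΓS (Γ (e 0))
    have hmap := map_mem_closure_span_pow ΓS (Γ (e 0))
    refine closure_span_pow_le hc hv (hpos.isPositive.mapsTo_of_sq hc fun x hx => ?_)
    rw [hsq]
    exact Submodule.add_mem _ (hmap _ (hmap _ hx)) (Submodule.smul_mem _ _ hv)
  · have hc := Submodule.isClosed_topologicalClosure
      (Submodule.span ℂ (Set.range fun n : ℕ => (Γ ^ n) (Γ (e 0))))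
    have hv := mem_closure_span_pow Γ (Γ (e 0))
    have hmap := map_mem_closure_span_pow Γ (Γ (e 0))
    refine closure_span_pow_le hc hv (hposS.isPositive.mapsTo_of_sq hc fun x hx => ?_)
    rw [eq_sub_of_add_eq (hsq x).symm]
    exact Submodule.sub_mem _ (hmap _ (hmap _ hx)) (Submodule.smul_mem _ _ hv)
end
end

section
/- Let C > 0 and let ξ : ℝ → [0,1] be a measurable function with ξ(λ) = 0 for λ ∉ [0,C]. Then there exists a finite positive Borel measure ρ̃ on ℝ, supported in [0,C], with ρ̃({0}) = 0 and ρ̃(ℝ) ≤ 1, such that for every z ∈ ℂ∖[0,C]: 1 − exp(−∫₀^∞ ξ(λ)/(λ − z) dλ) = ∫ λ/(λ − z) dρ̃(λ). -/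
open MeasureTheory

open Filter Topology

/-- The difference of two products of factors bounded by `M`. -/
lemma norm_prod_sub_prod_le_of_norm_le {p q : ℕ → ℂ} {M ε : ℝ} (hM : 1 ≤ M) (n : ℕ)
    (hp : ∀ k < n, ‖p k‖ ≤ M) (hq : ∀ k < n, ‖q k‖ ≤ M) (hpq : ∀ k < n, ‖p k - q k‖ ≤ ε) :
    ‖∏ k ∈ Finset.range n, p k - ∏ k ∈ Finset.range n, q k‖ ≤ n * ε * M ^ n := by
  induction n with
  | zero => simp
  | succ n ih =>
    have hε : 0 ≤ ε := (norm_nonneg _).trans (hpq n n.lt_succ_self)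
    have hP : ‖∏ k ∈ Finset.range n, p k‖ ≤ M ^ n := by
      rw [norm_prod]
      calc ∏ k ∈ Finset.range n, ‖p k‖ ≤ ∏ _k ∈ Finset.range n, M :=
            Finset.prod_le_prod (fun _ _ => norm_nonneg _)
              fun k hk => hp k (by simp at hk; lia)
        _ = M ^ n := by simp
    have ih' := ih (fun k hk => hp k (by lia)) (fun k hk => hq k (by lia))
      (fun k hk => hpq k (by lia))
    rw [Finset.prod_range_succ, Finset.prod_range_succ]
    set P := ∏ k ∈ Finset.range n, p k
    set Q := ∏ k ∈ Finset.range n, q k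
    have hMn : M ^ n ≤ M ^ (n + 1) := pow_le_pow_right₀ hM n.le_succ
    calc ‖P * p n - Q * q n‖ = ‖P * (p n - q n) + (P - Q) * q n‖ := by congr 1; ring
      _ ≤ ‖P‖ * ‖p n - q n‖ + ‖P - Q‖ * ‖q n‖ := by
          simpa only [norm_mul] using norm_add_le (P * (p n - q n)) ((P - Q) * q n)
      _ ≤ M ^ n * ε + (n * ε * M ^ n) * M := by
          gcongr
          · exact hpq n n.lt_succ_self
          · exact hq n n.lt_succ_self
      _ ≤ M ^ (n + 1) * ε + (n * ε * M ^ n) * M := by gcongr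
      _ = (n + 1 : ℕ) * ε * M ^ (n + 1) := by push_cast; ring

/-- Partial fractions with nonnegative residues for a product whose zeros `b k - s k` and poles
`b k` interlace. -/
lemma exists_nonneg_prod_one_sub_div_eq {b s : ℕ → ℝ} (hb : StrictMono b) (hs : ∀ k, 0 ≤ s k)
    (hsb : ∀ j k, j < k → s k ≤ b k - b j) (n : ℕ) :
    ∃ m : ℕ → ℝ, (∀ k, 0 ≤ m k) ∧ ∀ z : ℂ, (∀ k < n, z ≠ b k) →
      ∏ k ∈ Finset.range n, (1 - (s k : ℂ) / (b k - z)) =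
        1 - ∑ k ∈ Finset.range n, (m k : ℂ) / (b k - z) := by
  induction n with
  | zero => exact ⟨fun _ => 0, fun _ => le_rfl, fun z _ => by simp⟩
  | succ n ih =>
    obtain ⟨m, hm, hprod⟩ := ih
    refine ⟨fun k => if k < n then m k * (1 - s n / (b n - b k)) else
      s n * (1 + ∑ j ∈ Finset.range n, m j / (b n - b j)), fun k => ?_, fun z hz => ?_⟩
    · dsimp only
      split_ifs with hk
      · refine mul_nonneg (hm k) (sub_nonneg.2 ?_)
        exact div_le_one_of_le₀ (hsb k n hk) (sub_nonneg.2 (hb hk).le)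
      · refine mul_nonneg (hs n) (add_nonneg zero_le_one (Finset.sum_nonneg fun j hj => ?_))
        exact div_nonneg (hm j) (sub_nonneg.2 (hb (Finset.mem_range.1 hj)).le)
    · rw [Finset.prod_range_succ, hprod z fun k hk => hz k (by lia), Finset.sum_range_succ]
      have hsum : ∑ k ∈ Finset.range n,
          (((if k < n then m k * (1 - s n / (b n - b k)) else
            s n * (1 + ∑ j ∈ Finset.range n, m j / (b n - b j)) : ℝ)) : ℂ) / (b k - z) =
          ∑ k ∈ Finset.range n, ((m k : ℂ) / (b k - z) -
            (m k : ℂ) / (b k - z) * ((s n : ℂ) / (b n - z)) -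
            (s n : ℂ) / (b n - z) * ((m k : ℂ) / (b n - b k))) := by
        refine Finset.sum_congr rfl fun k hk => ?_
        have hk := Finset.mem_range.1 hk
        rw [if_pos hk]
        have h1 : (b k : ℂ) - z ≠ 0 := sub_ne_zero.2 (hz k (by lia)).symm
        have h2 : (b n : ℂ) - z ≠ 0 := sub_ne_zero.2 (hz n (by lia)).symm
        have h3 : (b n : ℂ) - b k ≠ 0 := by
          exact_mod_cast (sub_pos.2 (hb hk)).ne'
        push_cast
        field_simp
        ring
      dsimp only
      rw [hsum, Finset.sum_sub_distrib, Finset.sum_sub_distrib, ← Finset.sum_mul,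
        ← Finset.mul_sum, if_neg (lt_irrefl n)]
      push_cast
      ring

/-- The finite atomic measure representing a product with interlacing zeros and poles. -/
lemma exists_finiteMeasure_integral_eq_one_sub_prod {b s : ℕ → ℝ} (hb : StrictMono b)
    (hs : ∀ k, 0 ≤ s k) (hsb : ∀ j k, j < k → s k ≤ b k - b j) (hb0 : ∀ k, 0 < b k)
    (hsb0 : ∀ k, s k ≤ b k) (n : ℕ) {K : Set ℝ} (hK : MeasurableSet K) (hbK : ∀ k < n, b k ∈ K) :
    ∃ μ : FiniteMeasure ℝ, μ.mass ≤ 1 ∧ μ Kᶜ = 0 ∧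
      ∀ z : ℂ, (∀ k < n, z ≠ b k) →
        ∫ l, (l : ℂ) / (l - z) ∂(μ : Measure ℝ) =
          1 - ∏ k ∈ Finset.range n, (1 - (s k : ℂ) / (b k - z)) := by
  obtain ⟨m, hm, hprod⟩ := exists_nonneg_prod_one_sub_div_eq hb hs hsb n
  have hc : ∀ k, 0 ≤ m k / b k := fun k => div_nonneg (hm k) (hb0 k).le
  let ν : Measure ℝ := ∑ k ∈ Finset.range n, ENNReal.ofReal (m k / b k) • Measure.dirac (b k)
  have hν : ν Set.univ ≤ 1 := by
    have h0 := hprod 0 fun k _ => by exact_mod_cast (hb0 k).ne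
    simp only [sub_zero] at h0
    have h1 : ∏ k ∈ Finset.range n, (1 - s k / b k) = 1 - ∑ k ∈ Finset.range n, m k / b k := by
      exact_mod_cast h0
    have h2 : 0 ≤ ∏ k ∈ Finset.range n, (1 - s k / b k) :=
      Finset.prod_nonneg fun k _ => sub_nonneg.2 (div_le_one_of_le₀ (hsb0 k) (hb0 k).le)
    have h3 : ν Set.univ = ENNReal.ofReal (∑ k ∈ Finset.range n, m k / b k) := by
      rw [ENNReal.ofReal_sum_of_nonneg fun k _ => hc k]
      simp [ν]
    rw [h3]
    exact ENNReal.ofReal_le_one.2 (by linarith)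
  have hfin : IsFiniteMeasure ν := ⟨hν.trans_lt ENNReal.one_lt_top⟩
  let μ : FiniteMeasure ℝ := ⟨ν, hfin⟩
  refine ⟨μ, ?_, ?_, fun z hz => ?_⟩
  · rw [← ENNReal.coe_le_coe, FiniteMeasure.ennreal_mass]
    exact hν
  · rw [← ENNReal.coe_eq_zero, FiniteMeasure.ennreal_coeFn_eq_coeFn_toMeasure]
    change ν Kᶜ = 0
    simp only [ν, Measure.coe_finsetSum, Finset.sum_apply, Measure.smul_apply, smul_eq_mul]
    refine Finset.sum_eq_zero fun k hk => ?_
    rw [Measure.dirac_apply' _ hK.compl]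
    simp [hbK k (Finset.mem_range.1 hk)]
  · change ∫ l, (l : ℂ) / (l - z) ∂ν = _
    rw [hprod z hz, sub_sub_cancel]
    simp only [ν]
    rw [integral_finsetSum_measure]
    · refine Finset.sum_congr rfl fun k _ => ?_
      rw [integral_smul_measure, integral_dirac, ENNReal.toReal_ofReal (hc k), Complex.real_smul]
      have : (b k : ℂ) ≠ 0 := by exact_mod_cast (hb0 k).ne'
      push_cast
      field_simp
    · intro k _
      exact (integrable_dirac (by simp)).smul_measure ENNReal.ofReal_ne_top

/-- Compare the factor attached to `[u, b]` with the exponential of the Cauchy integral of `ξ`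
over `[u, b]`. -/
lemma norm_one_sub_div_sub_exp_le {ξ : ℝ → ℝ} (hmeas : Measurable ξ)
    (h01 : ∀ l, ξ l ∈ Set.Icc (0 : ℝ) 1) {u b d : ℝ} {z : ℂ} (hub : u ≤ b) (hd : 0 < d)
    (hz : ∀ t ∈ Set.Icc u b, d ≤ ‖(t : ℂ) - z‖) (hh : (b - u) / d ≤ 1) :
    IntervalIntegrable (fun l => (ξ l : ℂ) / (l - z)) volume u b ∧
    ‖∫ l in u..b, (ξ l : ℂ) / (l - z)‖ ≤ (b - u) / d ∧
    ‖1 - ((∫ l in u..b, ξ l : ℝ) : ℂ) / (b - z) - Complex.exp (-∫ l in u..b, (ξ l : ℂ) / (l - z))‖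
      ≤ 2 * ((b - u) / d) ^ 2 := by
  have hξ : ∀ l, ‖(ξ l : ℂ)‖ ≤ 1 := fun l => by
    rw [Complex.norm_real, Real.norm_of_nonneg (h01 l).1]
    exact (h01 l).2
  have hbz : d ≤ ‖(b : ℂ) - z‖ := hz b ⟨hub, le_rfl⟩
  have hbz0 : (b : ℂ) - z ≠ 0 := norm_pos_iff.1 (hd.trans_le hbz)
  have hbound : ∀ l ∈ Set.Ioc u b, ‖(ξ l : ℂ) / (l - z)‖ ≤ 1 / d := fun l hl => by
    rw [norm_div]
    exact div_le_div₀ zero_le_one (hξ l) hd (hz l (Set.Ioc_subset_Icc_self hl))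
  have hfin : volume (Set.Ioc u b) ≠ ⊤ := by simp
  have hint : IntervalIntegrable (fun l => (ξ l : ℂ) / (l - z)) volume u b := by
    rw [intervalIntegrable_iff_integrableOn_Ioc_of_le hub]
    exact Measure.integrableOn_of_bounded (M := 1 / d) hfin
      (Measurable.aestronglyMeasurable (by fun_prop)) ((ae_restrict_iff' measurableSet_Ioc).2 (Eventually.of_forall hbound))
  have hintξ : IntervalIntegrable (fun l => (ξ l : ℂ)) volume u b := by
    rw [intervalIntegrable_iff_integrableOn_Ioc_of_le hub]
    exact Measure.integrableOn_of_bounded (M := 1) hfin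
      (by fun_prop) (Eventually.of_forall hξ)
  have hw : ‖∫ l in u..b, (ξ l : ℂ) / (l - z)‖ ≤ (b - u) / d := by
    have := intervalIntegral.norm_integral_le_of_norm_le_const (a := u) (b := b)
      (f := fun l => (ξ l : ℂ) / (l - z)) (C := 1 / d)
      (by rw [Set.uIoc_of_le hub]; exact hbound)
    rw [abs_of_nonneg (sub_nonneg.2 hub)] at this
    exact this.trans_eq (by ring)
  refine ⟨hint, hw, ?_⟩
  have hdiff : ‖(∫ l in u..b, (ξ l : ℂ) / (l - z)) - ((∫ l in u..b, ξ l : ℝ) : ℂ) / (b - z)‖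
      ≤ ((b - u) / d) ^ 2 := by
    rw [← intervalIntegral.integral_ofReal, ← intervalIntegral.integral_div,
      ← intervalIntegral.integral_sub hint (hintξ.div_const _)]
    have := intervalIntegral.norm_integral_le_of_norm_le_const (a := u) (b := b)
      (f := fun l => (ξ l : ℂ) / (l - z) - (ξ l : ℂ) / (b - z)) (C := (b - u) / (d * d)) ?_
    · rw [abs_of_nonneg (sub_nonneg.2 hub)] at this
      exact this.trans_eq (by ring)
    · rw [Set.uIoc_of_le hub]
      intro l hl
      have hlz : d ≤ ‖(l : ℂ) - z‖ := hz l (Set.Ioc_subset_Icc_self hl)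
      have hlz0 : (l : ℂ) - z ≠ 0 := norm_pos_iff.1 (hd.trans_le hlz)
      have : (ξ l : ℂ) / (l - z) - (ξ l : ℂ) / (b - z) =
          ξ l * ((b - l : ℝ) : ℂ) / ((l - z) * (b - z)) := by
        push_cast
        field_simp
        ring
      rw [this, norm_div, norm_mul, norm_mul, Complex.norm_real (b - l),
        Real.norm_of_nonneg (sub_nonneg.2 hl.2)]
      refine div_le_div₀ (sub_nonneg.2 hub) ?_ (mul_pos hd hd)
        (mul_le_mul hlz hbz hd.le (norm_nonneg _))
      calc ‖(ξ l : ℂ)‖ * (b - l) ≤ 1 * (b - u) :=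
            mul_le_mul (hξ l) (by linarith [hl.1]) (sub_nonneg.2 hl.2) zero_le_one
        _ = b - u := one_mul _
  set w := ∫ l in u..b, (ξ l : ℂ) / (l - z)
  have hexp : ‖Complex.exp (-w) - 1 - -w‖ ≤ ((b - u) / d) ^ 2 := by
    refine (Complex.norm_exp_sub_one_sub_id_le (by rw [norm_neg]; exact hw.trans hh)).trans ?_
    rw [norm_neg]
    gcongr
  calc _ = ‖(w - ((∫ l in u..b, ξ l : ℝ) : ℂ) / (b - z)) - (Complex.exp (-w) - 1 - -w)‖ := by
        congr 1
        ring
    _ ≤ ((b - u) / d) ^ 2 + ((b - u) / d) ^ 2 := (norm_sub_le _ _).trans (add_le_add hdiff hexp)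
    _ = 2 * ((b - u) / d) ^ 2 := by ring

lemma intervalIntegral_mem_Icc_of_mem_Icc {ξ : ℝ → ℝ}
    (h01 : ∀ l, ξ l ∈ Set.Icc (0 : ℝ) 1) {u b : ℝ} (hub : u ≤ b) :
    ∫ l in u..b, ξ l ∈ Set.Icc 0 (b - u) := by
  refine ⟨intervalIntegral.integral_nonneg hub fun l _ => (h01 l).1, ?_⟩
  have := intervalIntegral.norm_integral_le_of_norm_le_const (a := u) (b := b) (f := ξ) (C := 1)
    fun l _ => by rw [Real.norm_of_nonneg (h01 l).1]; exact (h01 l).2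
  rw [one_mul, abs_of_nonneg (sub_nonneg.2 hub)] at this
  exact (le_abs_self _).trans this

/-- Off `[0, C]`, the products attached to uniform subdivisions of `[0, C]` converge to the
exponential of the Cauchy integral of `ξ`. -/
lemma tendsto_prod_one_sub_div_exp {C : ℝ} (hC : 0 < C) {ξ : ℝ → ℝ} (hmeas : Measurable ξ)
    (h01 : ∀ l, ξ l ∈ Set.Icc (0 : ℝ) 1) {z : ℂ} (hz : ∀ t ∈ Set.Icc (0 : ℝ) C, z ≠ t) :
    Tendsto (fun n : ℕ => ∏ k ∈ Finset.range (n + 1),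
        (1 - ((∫ l in (k * (C / (n + 1)))..((k + 1) * (C / (n + 1))), ξ l : ℝ) : ℂ) /
          (((k + 1) * (C / (n + 1)) : ℝ) - z)))
      atTop (𝓝 (Complex.exp (-∫ l in (0 : ℝ)..C, (ξ l : ℂ) / (l - z)))) := by
  obtain ⟨t₀, ht₀, hmin⟩ := isCompact_Icc.exists_isMinOn (Set.nonempty_Icc.2 hC.le)
    (f := fun t : ℝ => ‖(t : ℂ) - z‖) (by fun_prop)
  set d := ‖(t₀ : ℂ) - z‖
  have hd : 0 < d := norm_pos_iff.2 (sub_ne_zero.2 (hz t₀ ht₀).symm)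
  have hdz : ∀ t ∈ Set.Icc (0 : ℝ) C, d ≤ ‖(t : ℂ) - z‖ := fun t ht => hmin ht
  have hlim : Tendsto (fun n : ℕ => C / ((n : ℝ) + 1)) atTop (𝓝 0) :=
    (tendsto_const_div_atTop_nhds_zero_nat C).comp (tendsto_add_atTop_nat 1) |>.congr
      fun n => by simp
  have hsmall : ∀ᶠ n : ℕ in atTop, C / ((n : ℝ) + 1) < d := hlim.eventually_lt_const hd
  rw [tendsto_iff_norm_sub_tendsto_zero]
  have hlim' : Tendsto (fun n : ℕ => 2 * C / d ^ 2 * Real.exp (C / d) * (C / ((n : ℝ) + 1)))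
      atTop (𝓝 0) := by simpa using hlim.const_mul (2 * C / d ^ 2 * Real.exp (C / d))
  refine squeeze_zero' (Eventually.of_forall fun _ => norm_nonneg _) ?_ hlim'
  filter_upwards [hsmall] with n hn
  have hn0 : (0 : ℝ) < n + 1 := by positivity
  set h := C / ((n : ℝ) + 1) with hh
  have hh0 : 0 < h := div_pos hC hn0
  have hhC : (n + 1) * h = C := by rw [hh]; field_simp
  have hmem : ∀ k < n + 1, Set.Icc (k * h) ((k + 1) * h) ⊆ Set.Icc 0 C := fun k hk => by
    refine Set.Icc_subset_Icc (by positivity) ?_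
    rw [← hhC]
    have : (k : ℝ) ≤ n := by exact_mod_cast Nat.lt_succ_iff.1 hk
    gcongr
  have hlen : ∀ k : ℕ, ((k : ℝ) + 1) * h - k * h = h := fun k => by ring
  have hfac := fun k (hk : k < n + 1) =>
    norm_one_sub_div_sub_exp_le hmeas h01 (u := k * h) (b := (k + 1) * h) (z := z)
      (by linarith [hlen k]) hd (fun t ht => hdz t (hmem k hk ht))
      (by rw [hlen]; exact (div_le_one hd).2 hn.le)
  simp only [hlen] at hfac
  have hsum : ∑ k ∈ Finset.range (n + 1), ∫ l in (k * h)..((k + 1) * h), (ξ l : ℂ) / (l - z) =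
      ∫ l in (0 : ℝ)..C, (ξ l : ℂ) / (l - z) := by
    have := intervalIntegral.sum_integral_adjacent_intervals (μ := volume)
      (f := fun l : ℝ => (ξ l : ℂ) / (l - z)) (a := fun k : ℕ => k * h) (n := n + 1)
      fun k hk => by simpa using (hfac k hk).1
    simpa [hhC] using this
  rw [← hsum, ← Finset.sum_neg_distrib, Complex.exp_sum]
  have hexp : 1 + h / d ≤ Real.exp (h / d) := by linarith [Real.add_one_le_exp (h / d)]
  have hMn : Real.exp (h / d) ^ (n + 1) = Real.exp (C / d) := by
    rw [← Real.exp_nat_mul]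
    congr 1
    rw [← hhC]
    push_cast
    ring
  refine (norm_prod_sub_prod_le_of_norm_le (M := Real.exp (h / d)) (ε := 2 * (h / d) ^ 2)
    (Real.one_le_exp (by positivity)) (n + 1) (fun k hk => ?_) (fun k hk => ?_)
    fun k hk => (hfac k hk).2.2).trans_eq ?_
  · refine (norm_sub_le _ _).trans (le_trans ?_ hexp)
    rw [norm_one, norm_div, Complex.norm_real]
    have hs := intervalIntegral_mem_Icc_of_mem_Icc h01
      (show (k : ℝ) * h ≤ (k + 1) * h by linarith [hlen k])
    rw [hlen] at hs
    rw [Real.norm_of_nonneg hs.1]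
    gcongr
    · exact hs.2
    · exact hdz _ (hmem k hk ⟨by linarith [hlen k], le_rfl⟩)
  · refine (Complex.norm_exp_le_exp_norm _).trans (Real.exp_le_exp.2 ?_)
    rw [norm_neg]
    exact (hfac k hk).2.1
  · rw [hMn, ← hhC]
    push_cast
    ring

theorem statement16 (C : ℝ) (hC : 0 < C) (ξ : ℝ → ℝ) (hmeas : Measurable ξ)
    (h01 : ∀ l : ℝ, ξ l ∈ Set.Icc (0 : ℝ) 1)
    (hsupp : ∀ l : ℝ, l ∉ Set.Icc (0 : ℝ) C → ξ l = 0) :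
    ∃ ρ : Measure ℝ, IsFiniteMeasure ρ ∧
      ρ (Set.Icc (0 : ℝ) C)ᶜ = 0 ∧ ρ {0} = 0 ∧ ρ Set.univ ≤ 1 ∧
      ∀ z : ℂ, (∀ t : ℝ, t ∈ Set.Icc (0 : ℝ) C → z ≠ (t : ℂ)) →
        1 - Complex.exp (-∫ l in Set.Ioi (0 : ℝ), (ξ l : ℂ) / ((l : ℂ) - z)) =
          ∫ l, (l : ℂ) / ((l : ℂ) - z) ∂ρ := by
  let h : ℕ → ℝ := fun n => C / (n + 1)
  have hh0 : ∀ n, 0 < h n := fun n => by positivity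
  have hhC : ∀ n : ℕ, (n + 1) * h n = C := fun n => by simp only [h]; field_simp
  have hs : ∀ n k : ℕ, ∫ l in (k * h n)..((k + 1) * h n), ξ l ∈ Set.Icc 0 (h n) := fun n k => by
    have hlen : ((k : ℝ) + 1) * h n - k * h n = h n := by ring
    have := intervalIntegral_mem_Icc_of_mem_Icc h01
      (show (k : ℝ) * h n ≤ (k + 1) * h n by linarith [hh0 n])
    rwa [hlen] at this
  have hbK : ∀ n k : ℕ, k < n + 1 → ((k : ℝ) + 1) * h n ∈ Set.Icc 0 C := fun n k hk => by
    refine ⟨mul_nonneg (by positivity) (hh0 n).le, ?_⟩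
    rw [← hhC n]
    have : (k : ℝ) ≤ n := by exact_mod_cast Nat.lt_succ_iff.1 hk
    have := (hh0 n).le
    gcongr
  choose μ hμ1 hμK hμz using fun n : ℕ =>
    exists_finiteMeasure_integral_eq_one_sub_prod (b := fun k => (k + 1) * h n)
      (s := fun k => ∫ l in (k * h n)..((k + 1) * h n), ξ l)
      (fun j k hjk => mul_lt_mul_of_pos_right (by simpa using hjk) (hh0 n))
      (fun k => (hs n k).1)
      (fun j k hjk => by
        have hjk' : (j : ℝ) + 1 ≤ k := by exact_mod_cast hjk
        nlinarith [(hs n k).2, hh0 n])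
      (fun k => mul_pos (by positivity) (hh0 n))
      (fun k => (hs n k).2.trans (by nlinarith [hh0 n, (Nat.cast_nonneg k : (0 : ℝ) ≤ k)]))
      (n + 1) measurableSet_Icc (hbK n)
  obtain ⟨ν, ⟨hν1, hνK⟩, hν⟩ :=
    (isCompact_setOfPred_finiteMeasure_le_of_isCompact 1
      (isCompact_Icc : IsCompact (Set.Icc (0 : ℝ) C))).ultrafilter_le_nhds
      ((hyperfilter ℕ).map μ) (by
        rw [Ultrafilter.coe_map, le_principal_iff]
        exact mem_map.2 (Eventually.of_forall fun n => ⟨hμ1 n, hμK n⟩))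
  have hνlim : Tendsto μ (hyperfilter ℕ) (𝓝 ν) := hν
  have hae : ∀ μ' : FiniteMeasure ℝ, μ' (Set.Icc (0 : ℝ) C)ᶜ = 0 →
      (μ' : Measure ℝ) (Set.Icc (0 : ℝ) C)ᶜ = 0 := fun μ' hμ' => by
    rw [← FiniteMeasure.ennreal_coeFn_eq_coeFn_toMeasure, hμ', ENNReal.coe_zero]
  refine ⟨(ν : Measure ℝ).restrict {0}ᶜ, inferInstance, ?_, ?_, ?_, fun z hz => ?_⟩
  · exact le_antisymm ((Measure.restrict_apply_le _ _).trans_eq (hae ν hνK)) zero_le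
  · simp [Measure.restrict_apply (measurableSet_singleton (0 : ℝ))]
  · refine (Measure.restrict_apply_le _ _).trans ?_
    rw [← FiniteMeasure.ennreal_mass]
    exact_mod_cast hν1
  have hIoi : ∫ l in Set.Ioi (0 : ℝ), (ξ l : ℂ) / (l - z) =
      ∫ l in (0 : ℝ)..C, (ξ l : ℂ) / (l - z) := by
    rw [intervalIntegral.integral_of_le hC.le]
    refine setIntegral_eq_of_subset_of_forall_sdiff_eq_zero measurableSet_Ioi
      (fun l hl => hl.1) fun l hl => ?_
    rw [hsupp l fun hl' => hl.2 ⟨hl.1, hl'.2⟩]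
    simp
  have hrestrict : ∫ l in {0}ᶜ, (l : ℂ) / (l - z) ∂(ν : Measure ℝ) =
      ∫ l, (l : ℂ) / (l - z) ∂(ν : Measure ℝ) :=
    setIntegral_eq_integral_of_forall_compl_eq_zero fun l hl => by
      have : l = 0 := by simpa using hl
      simp [this]
  rw [hIoi, hrestrict]
  -- A bounded continuous extension of the kernel from `[0, C]` to `ℝ`.
  let φ : C(Set.Icc (0 : ℝ) C, ℂ) := ⟨fun t => ((t : ℝ) : ℂ) / ((t : ℝ) - z), by
    refine Continuous.div (by fun_prop) (by fun_prop) fun t => ?_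
    exact sub_ne_zero.2 (hz t t.2).symm⟩
  let g : BoundedContinuousFunction ℝ ℂ :=
    (BoundedContinuousFunction.mkOfCompact φ).compContinuous
      ⟨Set.projIcc 0 C hC.le, continuous_projIcc⟩
  have hg : ∀ l ∈ Set.Icc (0 : ℝ) C, g l = (l : ℂ) / (l - z) := fun l hl => by
    simp [g, φ, Set.projIcc_of_mem hC.le hl]
  have hgint : ∀ μ' : FiniteMeasure ℝ, μ' (Set.Icc (0 : ℝ) C)ᶜ = 0 →
      ∫ l, g l ∂(μ' : Measure ℝ) = ∫ l, (l : ℂ) / (l - z) ∂(μ' : Measure ℝ) := fun μ' hμ' =>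
    integral_congr_ae (by
      filter_upwards [compl_mem_ae_iff.2 (hae μ' hμ')] with l hl
      exact hg l (by simpa using hl))
  have hlim := (FiniteMeasure.tendsto_iff_forall_integral_rclike_tendsto ℂ).1 hνlim g
  rw [hgint ν hνK] at hlim
  have hprod := (tendsto_prod_one_sub_div_exp hC hmeas h01 hz).const_sub 1
  refine tendsto_nhds_unique ((hprod.mono_left Nat.hyperfilter_le_atTop).congr fun n => ?_) hlim
  rw [hgint _ (hμK n), hμz n z fun k hk => hz _ (hbK n k hk)]
end
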